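/- (Proposition 3, main case) If 0 ≤ a + Δr_i < d for all i = 1,…,k, then, writing N_0 = (N − a)/d, the reconstruction N̄ = d·N_0 + ⌊(Σ_{i=1}^k (r̄_i mod d))/k⌋ satisfies N̄ = N + ⌊(Σ_{i=1}^k Δr_i)/k⌋, and consequently |N − N̄| < d/4. -/

import Mathlib

/-- Proposition 3, main case (c): if `0 ≤ a + Δr i < d` for all `i`, then, writing
`N₀ = (N - a) / d`, the reconstruction `N̄ = d * N₀ + ⌊(∑ i, (r̄ i % d)) / k⌋` satisfies
`N̄ = N + ⌊(∑ i, Δr i) / k⌋`, and consequently `|N - N̄| < d / 4`. -/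
theorem prop3_case_c_reconstruction
    (k : ℕ) (hk : 0 < k) (d : ℤ) (hd : 0 < d)
    (m : Fin k → ℤ) (hm : ∀ i, 0 < m i)
    (hcop : ∀ i j, i ≠ j → IsCoprime (m i) (m j))
    (M : ℤ) (hM : M = ∏ i, m i)
    (r : Fin k → ℤ) (hr : ∀ i, 0 ≤ r i ∧ r i < d * m i)
    (hcong : ∀ i j, d ∣ r i - r j)
    (N : ℤ) (hNrange : 0 ≤ N ∧ N < d * M)
    (hN : ∀ i, N ≡ r i [ZMOD d * m i])
    (a : ℤ) (ha : a = r ⟨0, hk⟩ % d)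
    (Δr : Fin k → ℤ) (hΔ : ∀ i, 4 * |Δr i| < d)
    (rb : Fin k → ℤ) (hrb : ∀ i, rb i = r i + Δr i)
    (hrb_range : ∀ i, 0 ≤ rb i ∧ rb i < d * m i)
    (hcase : ∀ i, 0 ≤ a + Δr i ∧ a + Δr i < d)
    (N₀ : ℤ) (hN₀ : N₀ = (N - a) / d)
    (Nb : ℤ) (hNb : Nb = d * N₀ + (∑ i, rb i % d) / (k : ℤ)) :
    Nb = N + (∑ i, Δr i) / (k : ℤ) ∧ 4 * |N - Nb| < d := by
  have hk' : (0 : ℤ) < k := by exact_mod_cast hk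
  have hmod : ∀ i, rb i % d = a + Δr i := by
    intro i
    obtain ⟨c, hc⟩ := hcong i ⟨0, hk⟩
    have h1 := Int.emod_add_mul_ediv (r ⟨0, hk⟩) d
    rw [← ha] at h1
    have h2 : rb i = (a + Δr i) + d * (r ⟨0, hk⟩ / d + c) := by
      rw [hrb i]
      linarith
    rw [h2, Int.add_mul_emod_self_left]
    exact Int.emod_eq_of_lt (hcase i).1 (hcase i).2
  have hsum : (∑ i, rb i % d) = (∑ i, Δr i) + a * (k : ℤ) := by
    simp only [hmod, Finset.sum_add_distrib, Finset.sum_const, Finset.card_univ,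
      Fintype.card_fin, nsmul_eq_mul]
    ring
  have hdvd : d ∣ N - a := by
    have h1 : d ∣ r ⟨0, hk⟩ - N := (Dvd.intro _ rfl).trans (hN ⟨0, hk⟩).dvd
    have h2 : d ∣ r ⟨0, hk⟩ - a := by
      rw [ha]
      exact Int.dvd_self_sub_emod
    have h3 := dvd_sub h2 h1
    have h4 : r ⟨0, hk⟩ - a - (r ⟨0, hk⟩ - N) = N - a := by ring
    rwa [h4] at h3
  have hmain : Nb = N + (∑ i, Δr i) / (k : ℤ) := by
    rw [hNb, hN₀, Int.mul_ediv_cancel' hdvd, hsum, Int.add_mul_ediv_right _ _ hk'.ne']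
    ring
  refine ⟨hmain, ?_⟩
  obtain ⟨B, hB⟩ : ∃ B : ℤ, B = (d - 1) / 4 := ⟨_, rfl⟩
  have hb : ∀ i, |Δr i| ≤ B := by
    intro i
    have := hΔ i
    omega
  have hS : |∑ i, Δr i| ≤ k * B := by
    refine (Finset.abs_sum_le_sum_abs _ _).trans ?_
    refine (Finset.sum_le_sum fun i _ => hb i).trans ?_
    simp
  obtain ⟨hS1, hS2⟩ := abs_le.mp hS
  have hq1 : -B ≤ (∑ i, Δr i) / (k : ℤ) := by
    rw [Int.le_ediv_iff_mul_le hk']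
    linarith
  have hq2 : (∑ i, Δr i) / (k : ℤ) ≤ B := by
    refine Int.ediv_le_of_le_mul hk' ?_
    linarith
  have habs : |N - Nb| ≤ B := by
    rw [abs_le]
    constructor <;> linarith
  omega
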